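/- Let A ∈ ℝ^{n×n} be block-partitioned as A = [[A₁₁, A₁₂],[A₂₁, A₂₂]] with A₁₁ ∈ ℝ^{m×m}, and let B = [I_m; 0] ∈ ℝ^{n×m}. Suppose that A₂₁ ∈ ℝ^{(n−m)×m} has no zero rows (every follower is reached by at least one leader in one step) and that every column of A₂₁ is either zero or unisigned (for each leader, all its length-1 walks to followers have the same sign). Then the pair (A,B) is herdable. -/

import Mathlib

open Matrix

/-- A nonzero real vector is unisigned if all its nonzero entries have the same sign. -/
def Unisigned {ι : Type*} (v : ι → ℝ) : Prop :=
  v ≠ 0 ∧ ((∀ i, 0 ≤ v i) ∨ (∀ i, v i ≤ 0))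

/-- The controllability matrix `[B | AB | A²B | ... | A^{n-1}B]` of the pair `(A, B)`,
where the state is indexed by a finite type `I` of cardinality `n`. -/
def ctrbMat {I : Type*} [Fintype I] [DecidableEq I] {m : ℕ}
    (A : Matrix I I ℝ) (B : Matrix I (Fin m) ℝ) :
    Matrix I (Fin (Fintype.card I) × Fin m) ℝ :=
  Matrix.of fun i p => (A ^ (p.1 : ℕ) * B) i p.2

/-- Feeding an input through the `k`-th block of the controllability matrix only
yields `A ^ k * B` applied to that input. -/
theorem ctrbMat_mulVec_block {I : Type*} [Fintype I] [DecidableEq I] {m : ℕ}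
    (A : Matrix I I ℝ) (B : Matrix I (Fin m) ℝ) (k : Fin (Fintype.card I)) (c : Fin m → ℝ) :
    (ctrbMat A B).mulVec (fun q => if q.1 = k then c q.2 else 0) =
      (A ^ (k : ℕ) * B).mulVec c := by
  ext i
  simp only [ctrbMat, mulVec, dotProduct, Matrix.of_apply, Fintype.sum_prod_type, mul_ite,
    mul_zero]
  rw [Finset.sum_eq_single k]
  · simp
  · intro l _ hl
    simp [hl]
  · simp

/-- The matrix `[I; 0]` maps `c` to `(c, 0)`. -/
theorem identityOverZero_mulVec {m p : ℕ} (c : Fin m → ℝ) :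
    (Matrix.of fun (i : Fin m ⊕ Fin p) (j : Fin m) => if i = Sum.inl j then (1 : ℝ) else 0).mulVec
      c = Sum.elim c 0 := by
  ext (i | i) <;> simp [mulVec, dotProduct]

/-- If the columns of `M` are zero or unisigned and no row of `M` vanishes, then the image of
`M` contains a strictly positive vector. -/
theorem exists_mulVec_pos_of_unisigned_cols {ι κ : Type*} [Fintype κ] (M : Matrix ι κ ℝ)
    (hrows : ∀ i, ∃ j, M i j ≠ 0)
    (hcols : ∀ j, (fun i => M i j) = 0 ∨ Unisigned (fun i => M i j)) :
    ∃ s : κ → ℝ, ∀ i, 0 < M.mulVec s i := by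
  have hsign : ∀ j, ∃ t : ℝ, ∀ i, M i j * t = |M i j| := by
    intro j
    rcases hcols j with h | ⟨-, h | h⟩
    · exact ⟨0, fun i => by simp [show M i j = 0 from congrFun h i]⟩
    · exact ⟨1, fun i => by rw [mul_one, abs_of_nonneg (h i)]⟩
    · exact ⟨-1, fun i => by rw [mul_neg_one, abs_of_nonpos (h i)]⟩
  choose s hs using hsign
  refine ⟨s, fun i => ?_⟩
  obtain ⟨j, hj⟩ := hrows i
  simp only [mulVec, dotProduct, hs]
  exact Finset.sum_pos' (fun j _ => abs_nonneg _) ⟨j, Finset.mem_univ j, abs_pos.mpr hj⟩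

theorem stmt10 {m p : ℕ}
    (A₁₁ : Matrix (Fin m) (Fin m) ℝ) (A₁₂ : Matrix (Fin m) (Fin p) ℝ)
    (A₂₁ : Matrix (Fin p) (Fin m) ℝ) (A₂₂ : Matrix (Fin p) (Fin p) ℝ)
    (A : Matrix (Fin m ⊕ Fin p) (Fin m ⊕ Fin p) ℝ)
    (hA : A = Matrix.fromBlocks A₁₁ A₁₂ A₂₁ A₂₂)
    (B : Matrix (Fin m ⊕ Fin p) (Fin m) ℝ)
    -- B = [I_m ; 0]
    (hB : B = Matrix.of fun i j => if i = Sum.inl j then 1 else 0)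
    -- A₂₁ has no zero rows: every follower is reached by a leader in one step
    (hrows : ∀ i : Fin p, ∃ j, A₂₁ i j ≠ 0)
    -- every column of A₂₁ is zero or unisigned :
    -- each leader's length-1 walks to its followers have the same sign
    (hcols : ∀ j : Fin m, (fun i => A₂₁ i j) = 0 ∨ Unisigned (fun i => A₂₁ i j)) :
    -- the pair (A,B) is herdable
    ∃ u : Fin (Fintype.card (Fin m ⊕ Fin p)) × Fin m → ℝ,
      ∀ i, 0 < (ctrbMat A B).mulVec u i := by
  obtain ⟨s, hs⟩ := exists_mulVec_pos_of_unisigned_cols A₂₁ hrows hcols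
  have hcard : Fintype.card (Fin m ⊕ Fin p) = m + p := by simp
  rcases Nat.eq_zero_or_pos m with hm | hm
  · subst hm
    refine ⟨0, ?_⟩
    rintro (i | i)
    · exact i.elim0
    · exact (hrows i).choose.elim0
  let k₀ : Fin (Fintype.card (Fin m ⊕ Fin p)) := ⟨0, by omega⟩
  rcases Nat.eq_zero_or_pos p with hp | hp
  · subst hp
    refine ⟨fun q => if q.1 = k₀ then (fun _ => 1) q.2 else 0, ?_⟩
    rw [ctrbMat_mulVec_block A B k₀ fun _ => 1, pow_zero, Matrix.one_mul, hB,
      identityOverZero_mulVec]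
    rintro (i | i)
    · simp
    · exact i.elim0
  let k₁ : Fin (Fintype.card (Fin m ⊕ Fin p)) := ⟨1, by omega⟩
  let c : Fin m → ℝ := 1 - A₁₁.mulVec s
  refine ⟨(fun q => if q.1 = k₀ then c q.2 else 0) + (fun q => if q.1 = k₁ then s q.2 else 0), ?_⟩
  rw [mulVec_add, ctrbMat_mulVec_block A B k₀ c, ctrbMat_mulVec_block A B k₁ s, pow_zero, pow_one,
    Matrix.one_mul, ← mulVec_mulVec, hB, identityOverZero_mulVec, identityOverZero_mulVec, hA,
    fromBlocks_mulVec]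
  rintro (i | i)
  · simp [c]
  · simpa using hs i
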